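/- arXiv:2312.12449 — 10 statements merged into one kernel-verified Lean document; each statement's English description precedes it below -/
import Mathlib

section
/- Let (A, ≺_λ, ≻_λ) be a dendriform conformal algebra and let α, β : A → A be two commuting endomorphisms of it (ℂ-linear maps commuting with ∂ and with each other, preserving both products: α(p ≺_λ q) = α(p) ≺_λ α(q), α(p ≻_λ q) = α(p) ≻_λ α(q), and similarly for β). Define new products by p ≺^{(α,β)}_λ q = α(p) ≺_λ β(q) and p ≻^{(α,β)}_λ q = α(p) ≻_λ β(q). Then (A, ≺^{(α,β)}_λ, ≻^{(α,β)}_λ, α, β) is a BiHom-dendriform conformal algebra (the Yau twist of A). -/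
open scoped TensorProduct

/-- A conformally sesquilinear family of `ℂ`-bilinear maps (a "λ-product" when all
spaces and derivations coincide): `f l (D p) q = -l • f l p q` and
`f l p (D q) = D (f l p q) + l • f l p q`. -/
structure ConfSesq {M N P : Type*} [AddCommGroup M] [Module ℂ M]
    [AddCommGroup N] [Module ℂ N] [AddCommGroup P] [Module ℂ P]
    (DM : M →ₗ[ℂ] M) (DN : N →ₗ[ℂ] N) (DP : P →ₗ[ℂ] P)
    (f : ℂ → M → N → P) : Prop where
  add_left : ∀ (l : ℂ) (p p' : M) (q : N), f l (p + p') q = f l p q + f l p' q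
  smul_left : ∀ (l c : ℂ) (p : M) (q : N), f l (c • p) q = c • f l p q
  add_right : ∀ (l : ℂ) (p : M) (q q' : N), f l p (q + q') = f l p q + f l p q'
  smul_right : ∀ (l c : ℂ) (p : M) (q : N), f l p (c • q) = c • f l p q
  sesq_left : ∀ (l : ℂ) (p : M) (q : N), f l (DM p) q = (-l) • f l p q
  sesq_right : ∀ (l : ℂ) (p : M) (q : N), f l p (DN q) = DP (f l p q) + l • f l p q

/-- BiHom-associative conformal algebra. -/
structure BiHomAssocConformal (A : Type*) [AddCommGroup A] [Module ℂ A]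
    (D α β : A →ₗ[ℂ] A) (m : ℂ → A → A → A) : Prop where
  sesq : ConfSesq D D D m
  comm_ab : ∀ p, α (β p) = β (α p)
  comm_aD : ∀ p, α (D p) = D (α p)
  comm_bD : ∀ p, β (D p) = D (β p)
  mult_a : ∀ (l : ℂ) p q, α (m l p q) = m l (α p) (α q)
  mult_b : ∀ (l : ℂ) p q, β (m l p q) = m l (β p) (β q)
  assoc : ∀ (l μ : ℂ) p q r, m l (α p) (m μ q r) = m (l + μ) (m l p q) (β r)

/-- BiHom-dendriform conformal algebra. -/
structure BiHomDendriformConformal (A : Type*) [AddCommGroup A] [Module ℂ A]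
    (D α β : A →ₗ[ℂ] A) (pr su : ℂ → A → A → A) : Prop where
  sesq_pr : ConfSesq D D D pr
  sesq_su : ConfSesq D D D su
  comm_ab : ∀ p, α (β p) = β (α p)
  comm_aD : ∀ p, α (D p) = D (α p)
  comm_bD : ∀ p, β (D p) = D (β p)
  mult_a_pr : ∀ (l : ℂ) p q, α (pr l p q) = pr l (α p) (α q)
  mult_b_pr : ∀ (l : ℂ) p q, β (pr l p q) = pr l (β p) (β q)
  mult_a_su : ∀ (l : ℂ) p q, α (su l p q) = su l (α p) (α q)
  mult_b_su : ∀ (l : ℂ) p q, β (su l p q) = su l (β p) (β q)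
  d1 : ∀ (l μ : ℂ) p q r, pr (l + μ) (pr l p q) (β r) = pr l (α p) (pr μ q r + su μ q r)
  d2 : ∀ (l μ : ℂ) p q r, pr (l + μ) (su l p q) (β r) = su l (α p) (pr μ q r)
  d3 : ∀ (l μ : ℂ) p q r, su l (α p) (su μ q r) = su (l + μ) (pr l p q + su l p q) (β r)

/-- BiHom-tridendriform conformal algebra. -/
structure BiHomTridendriformConformal (A : Type*) [AddCommGroup A] [Module ℂ A]
    (D α β : A →ₗ[ℂ] A) (pr su dt : ℂ → A → A → A) : Prop where
  sesq_pr : ConfSesq D D D pr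
  sesq_su : ConfSesq D D D su
  sesq_dt : ConfSesq D D D dt
  comm_ab : ∀ p, α (β p) = β (α p)
  comm_aD : ∀ p, α (D p) = D (α p)
  comm_bD : ∀ p, β (D p) = D (β p)
  mult_a_pr : ∀ (l : ℂ) p q, α (pr l p q) = pr l (α p) (α q)
  mult_b_pr : ∀ (l : ℂ) p q, β (pr l p q) = pr l (β p) (β q)
  mult_a_su : ∀ (l : ℂ) p q, α (su l p q) = su l (α p) (α q)
  mult_b_su : ∀ (l : ℂ) p q, β (su l p q) = su l (β p) (β q)
  mult_a_dt : ∀ (l : ℂ) p q, α (dt l p q) = dt l (α p) (α q)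
  mult_b_dt : ∀ (l : ℂ) p q, β (dt l p q) = dt l (β p) (β q)
  t1 : ∀ (l μ : ℂ) p q r,
    pr (l + μ) (pr l p q) (β r) = pr l (α p) (pr μ q r + su μ q r + dt μ q r)
  t2 : ∀ (l μ : ℂ) p q r, pr (l + μ) (su l p q) (β r) = su l (α p) (pr μ q r)
  t3 : ∀ (l μ : ℂ) p q r,
    su l (α p) (su μ q r) = su (l + μ) (pr l p q + su l p q + dt l p q) (β r)
  t4 : ∀ (l μ : ℂ) p q r, dt l (α p) (su μ q r) = dt (l + μ) (pr l p q) (β r)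
  t5 : ∀ (l μ : ℂ) p q r, su l (α p) (dt μ q r) = dt (l + μ) (su l p q) (β r)
  t6 : ∀ (l μ : ℂ) p q r, dt l (α p) (pr μ q r) = pr (l + μ) (dt l p q) (β r)
  t7 : ∀ (l μ : ℂ) p q r, dt l (α p) (dt μ q r) = dt (l + μ) (dt l p q) (β r)

/-- BiHom-NS-conformal algebra. -/
structure BiHomNSConformal (A : Type*) [AddCommGroup A] [Module ℂ A]
    (D α β : A →ₗ[ℂ] A) (pr su ve : ℂ → A → A → A) : Prop where
  sesq_pr : ConfSesq D D D pr
  sesq_su : ConfSesq D D D su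
  sesq_ve : ConfSesq D D D ve
  comm_ab : ∀ p, α (β p) = β (α p)
  comm_aD : ∀ p, α (D p) = D (α p)
  comm_bD : ∀ p, β (D p) = D (β p)
  mult_a_pr : ∀ (l : ℂ) p q, α (pr l p q) = pr l (α p) (α q)
  mult_b_pr : ∀ (l : ℂ) p q, β (pr l p q) = pr l (β p) (β q)
  mult_a_su : ∀ (l : ℂ) p q, α (su l p q) = su l (α p) (α q)
  mult_b_su : ∀ (l : ℂ) p q, β (su l p q) = su l (β p) (β q)
  mult_a_ve : ∀ (l : ℂ) p q, α (ve l p q) = ve l (α p) (α q)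
  mult_b_ve : ∀ (l : ℂ) p q, β (ve l p q) = ve l (β p) (β q)
  ns1 : ∀ (l μ : ℂ) p q r,
    pr (l + μ) (pr l p q) (β r) = pr l (α p) (pr μ q r + su μ q r + ve μ q r)
  ns2 : ∀ (l μ : ℂ) p q r, pr (l + μ) (su l p q) (β r) = su l (α p) (pr μ q r)
  ns3 : ∀ (l μ : ℂ) p q r,
    su (l + μ) (pr l p q + su l p q + ve l p q) (β r) = su l (α p) (su μ q r)
  ns4 : ∀ (l μ : ℂ) p q r,
    pr (l + μ) (ve l p q) (β r) + ve (l + μ) (pr l p q + su l p q + ve l p q) (β r)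
      = su l (α p) (ve μ q r) + ve l (α p) (pr μ q r + su μ q r + ve μ q r)

/-- Conformal bimodule over a BiHom-associative conformal algebra. -/
structure ConformalBimodule (A M : Type*) [AddCommGroup A] [Module ℂ A]
    [AddCommGroup M] [Module ℂ M]
    (DA αA βA : A →ₗ[ℂ] A) (mA : ℂ → A → A → A)
    (DM αM βM : M →ₗ[ℂ] M)
    (lact : ℂ → A → M → M) (ract : ℂ → M → A → M) : Prop where
  sesq_l : ConfSesq DA DM DM lact
  sesq_r : ConfSesq DM DA DM ract
  comm_ab : ∀ x, αM (βM x) = βM (αM x)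
  l_a : ∀ (l : ℂ) p x, αM (lact l p x) = lact l (αA p) (αM x)
  l_b : ∀ (l : ℂ) p x, βM (lact l p x) = lact l (βA p) (βM x)
  r_a : ∀ (l : ℂ) x p, αM (ract l x p) = ract l (αM x) (αA p)
  r_b : ∀ (l : ℂ) x p, βM (ract l x p) = ract l (βM x) (βA p)
  assoc_ll : ∀ (l μ : ℂ) p q x, lact (l + μ) (mA l p q) (βM x) = lact l (αA p) (lact μ q x)
  assoc_rr : ∀ (l μ : ℂ) x p q, ract (l + μ) (ract l x p) (βA q) = ract l (αM x) (mA μ p q)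
  assoc_lr : ∀ (l μ : ℂ) p x q, ract (l + μ) (lact l p x) (βA q) = lact l (αA p) (ract μ x q)

/-- The multiplicativity conditions and the nine BiHom-quadri relations. -/
structure BiHomQuadriRel (Q : Type*) [AddCommGroup Q] [Module ℂ Q]
    (α β : Q →ₗ[ℂ] Q) (nw sw ne se : ℂ → Q → Q → Q) : Prop where
  mult_a_nw : ∀ (l : ℂ) p q, α (nw l p q) = nw l (α p) (α q)
  mult_b_nw : ∀ (l : ℂ) p q, β (nw l p q) = nw l (β p) (β q)
  mult_a_sw : ∀ (l : ℂ) p q, α (sw l p q) = sw l (α p) (α q)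
  mult_b_sw : ∀ (l : ℂ) p q, β (sw l p q) = sw l (β p) (β q)
  mult_a_ne : ∀ (l : ℂ) p q, α (ne l p q) = ne l (α p) (α q)
  mult_b_ne : ∀ (l : ℂ) p q, β (ne l p q) = ne l (β p) (β q)
  mult_a_se : ∀ (l : ℂ) p q, α (se l p q) = se l (α p) (α q)
  mult_b_se : ∀ (l : ℂ) p q, β (se l p q) = se l (β p) (β q)
  q1 : ∀ (l μ : ℂ) p q r, nw (l + μ) (nw l p q) (β r)
        = nw l (α p) (nw μ q r + sw μ q r + ne μ q r + se μ q r)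
  q2 : ∀ (l μ : ℂ) p q r, nw (l + μ) (ne l p q) (β r) = ne l (α p) (nw μ q r + sw μ q r)
  q3 : ∀ (l μ : ℂ) p q r, ne (l + μ) (nw l p q + ne l p q) (β r)
        = ne l (α p) (ne μ q r + se μ q r)
  q4 : ∀ (l μ : ℂ) p q r, nw (l + μ) (sw l p q) (β r) = sw l (α p) (nw μ q r + ne μ q r)
  q5 : ∀ (l μ : ℂ) p q r, ne (l + μ) (sw l p q + se l p q) (β r) = se l (α p) (ne μ q r)
  q6 : ∀ (l μ : ℂ) p q r, nw (l + μ) (se l p q) (β r) = se l (α p) (nw μ q r)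
  q7 : ∀ (l μ : ℂ) p q r, sw (l + μ) (nw l p q + sw l p q) (β r)
        = sw l (α p) (sw μ q r + se μ q r)
  q8 : ∀ (l μ : ℂ) p q r, se (l + μ) (nw l p q + sw l p q + ne l p q + se l p q) (β r)
        = se l (α p) (se μ q r)
  q9 : ∀ (l μ : ℂ) p q r, sw (l + μ) (ne l p q + se l p q) (β r) = se l (α p) (sw μ q r)

/-- BiHom-quadri conformal algebra. -/
structure BiHomQuadriConformal (Q : Type*) [AddCommGroup Q] [Module ℂ Q]
    (D α β : Q →ₗ[ℂ] Q) (nw sw ne se : ℂ → Q → Q → Q) : Prop where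
  sesq_nw : ConfSesq D D D nw
  sesq_sw : ConfSesq D D D sw
  sesq_ne : ConfSesq D D D ne
  sesq_se : ConfSesq D D D se
  comm_ab : ∀ p, α (β p) = β (α p)
  comm_aD : ∀ p, α (D p) = D (α p)
  comm_bD : ∀ p, β (D p) = D (β p)
  rel : BiHomQuadriRel Q α β nw sw ne se

/-- Rota-Baxter operator of weight `θ` on a conformal algebra with λ-product `m`. -/
structure RotaBaxterWeight (A : Type*) [AddCommGroup A] [Module ℂ A]
    (D : A →ₗ[ℂ] A) (m : ℂ → A → A → A) (θ : ℂ) (Rop : A →ₗ[ℂ] A) : Prop where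
  comm_D : ∀ p, Rop (D p) = D (Rop p)
  rb : ∀ (l : ℂ) p q,
    m l (Rop p) (Rop q) = Rop (m l (Rop p) q + m l p (Rop q) + θ • m l p q)

/-- Rota-Baxter system on a BiHom-associative conformal algebra. -/
structure RotaBaxterSystem (A : Type*) [AddCommGroup A] [Module ℂ A]
    (D α β : A →ₗ[ℂ] A) (m : ℂ → A → A → A) (Rop Sop : A →ₗ[ℂ] A) : Prop where
  R_D : ∀ p, Rop (D p) = D (Rop p)
  S_D : ∀ p, Sop (D p) = D (Sop p)
  R_a : ∀ p, Rop (α p) = α (Rop p)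
  R_b : ∀ p, Rop (β p) = β (Rop p)
  S_a : ∀ p, Sop (α p) = α (Sop p)
  S_b : ∀ p, Sop (β p) = β (Sop p)
  rb_R : ∀ (l : ℂ) p q, m l (Rop p) (Rop q) = Rop (m l (Rop p) q + m l p (Sop q))
  rb_S : ∀ (l : ℂ) p q, m l (Sop p) (Sop q) = Sop (m l (Rop p) q + m l p (Sop q))

/-- Rota-Baxter operator of weight 0 on a BiHom-dendriform conformal algebra. -/
structure RotaBaxterDendriform (A : Type*) [AddCommGroup A] [Module ℂ A]
    (D α β : A →ₗ[ℂ] A) (pr su : ℂ → A → A → A) (Rop : A →ₗ[ℂ] A) : Prop where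
  comm_D : ∀ p, Rop (D p) = D (Rop p)
  comm_a : ∀ p, Rop (α p) = α (Rop p)
  comm_b : ∀ p, Rop (β p) = β (Rop p)
  rb_su : ∀ (l : ℂ) p q, su l (Rop p) (Rop q) = Rop (su l p (Rop q) + su l (Rop p) q)
  rb_pr : ∀ (l : ℂ) p q, pr l (Rop p) (Rop q) = Rop (pr l p (Rop q) + pr l (Rop p) q)

/-- Rota-Baxter system on a BiHom-dendriform conformal algebra. -/
structure RotaBaxterSystemDendriform (A : Type*) [AddCommGroup A] [Module ℂ A]
    (D α β : A →ₗ[ℂ] A) (pr su : ℂ → A → A → A) (Rop Sop : A →ₗ[ℂ] A) : Prop where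
  R_D : ∀ p, Rop (D p) = D (Rop p)
  S_D : ∀ p, Sop (D p) = D (Sop p)
  R_a : ∀ p, Rop (α p) = α (Rop p)
  R_b : ∀ p, Rop (β p) = β (Rop p)
  S_a : ∀ p, Sop (α p) = α (Sop p)
  S_b : ∀ p, Sop (β p) = β (Sop p)
  rs_su_R : ∀ (l : ℂ) p q, su l (Rop p) (Rop q) = Rop (su l p (Sop q) + su l (Rop p) q)
  rs_pr_R : ∀ (l : ℂ) p q, pr l (Rop p) (Rop q) = Rop (pr l p (Sop q) + pr l (Rop p) q)
  rs_su_S : ∀ (l : ℂ) p q, su l (Sop p) (Sop q) = Sop (su l p (Sop q) + su l (Rop p) q)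
  rs_pr_S : ∀ (l : ℂ) p q, pr l (Sop p) (Sop q) = Sop (pr l p (Sop q) + pr l (Rop p) q)

/-- Hochschild 2-cocycle on a BiHom-associative conformal algebra with coefficients in
a conformal bimodule. -/
structure Hochschild2Cocycle (A M : Type*) [AddCommGroup A] [Module ℂ A]
    [AddCommGroup M] [Module ℂ M]
    (DA αA βA : A →ₗ[ℂ] A) (mA : ℂ → A → A → A)
    (DM αM βM : M →ₗ[ℂ] M)
    (lact : ℂ → A → M → M) (ract : ℂ → M → A → M)
    (H : ℂ → A → A → M) : Prop where
  sesq : ConfSesq DA DA DM H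
  comm_a : ∀ (l : ℂ) p q, H l (αA p) (αA q) = αM (H l p q)
  comm_b : ∀ (l : ℂ) p q, H l (βA p) (βA q) = βM (H l p q)
  cocycle : ∀ (l μ : ℂ) p q r,
    lact l (αA p) (H μ q r) - H (l + μ) (mA l p q) (βA r)
      + H l (αA p) (mA μ q r) - ract (l + μ) (H l p q) (βA r) = 0

/-- `H`-twisted Rota-Baxter operator `R : M → A`. -/
structure TwistedRotaBaxter (A M : Type*) [AddCommGroup A] [Module ℂ A]
    [AddCommGroup M] [Module ℂ M]
    (DA αA βA : A →ₗ[ℂ] A) (mA : ℂ → A → A → A)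
    (DM αM βM : M →ₗ[ℂ] M)
    (lact : ℂ → A → M → M) (ract : ℂ → M → A → M)
    (H : ℂ → A → A → M) (Rop : M →ₗ[ℂ] A) : Prop where
  comm_D : ∀ x, Rop (DM x) = DA (Rop x)
  comm_a : ∀ x, Rop (αM x) = αA (Rop x)
  comm_b : ∀ x, Rop (βM x) = βA (Rop x)
  twisted : ∀ (l : ℂ) x y, mA l (Rop x) (Rop y)
      = Rop (ract l x (Rop y) + lact l (Rop x) y + H l (Rop x) (Rop y))


/-- the Yau twist of a dendriform conformal algebra by two commuting
endomorphisms `α, β` is a BiHom-dendriform conformal algebra. -/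
theorem yau_twist_dendriform (A : Type*) [AddCommGroup A] [Module ℂ A]
    (D α β : A →ₗ[ℂ] A) (pr su : ℂ → A → A → A)
    (hA : BiHomDendriformConformal A D LinearMap.id LinearMap.id pr su)
    (hab : ∀ p, α (β p) = β (α p))
    (haD : ∀ p, α (D p) = D (α p))
    (hbD : ∀ p, β (D p) = D (β p))
    (ha_pr : ∀ (l : ℂ) p q, α (pr l p q) = pr l (α p) (α q))
    (ha_su : ∀ (l : ℂ) p q, α (su l p q) = su l (α p) (α q))
    (hb_pr : ∀ (l : ℂ) p q, β (pr l p q) = pr l (β p) (β q))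
    (hb_su : ∀ (l : ℂ) p q, β (su l p q) = su l (β p) (β q)) :
    BiHomDendriformConformal A D α β
      (fun l p q => pr l (α p) (β q)) (fun l p q => su l (α p) (β q)) := by
  have key : ∀ f : ℂ → A → A → A, ConfSesq D D D f →
      ConfSesq D D D (fun l p q => f l (α p) (β q)) := by
    intro f hf
    constructor
    · intro l p p' q
      simp only [map_add, hf.add_left]
    · intro l c p q
      simp only [map_smul, hf.smul_left]
    · intro l p q q'
      simp only [map_add, hf.add_right]
    · intro l c p q
      simp only [map_smul, hf.smul_right]
    · intro l p q
      simp only [haD, hf.sesq_left]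
    · intro l p q
      simp only [hbD, hf.sesq_right]
  have d1 := hA.d1
  have d2 := hA.d2
  have d3 := hA.d3
  simp only [LinearMap.id_apply] at d1 d2 d3
  refine ⟨key pr hA.sesq_pr, key su hA.sesq_su, hab, haD, hbD, ?_, ?_, ?_, ?_, ?_, ?_, ?_⟩
  · intro l p q
    simp only [ha_pr, hab]
  · intro l p q
    simp only [hb_pr, hab]
  · intro l p q
    simp only [ha_su, hab]
  · intro l p q
    simp only [hb_su, hab]
  · intro l μ p q r
    simp only [map_add, ha_pr, hb_pr, hb_su, hab, d1]
  · intro l μ p q r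
    simp only [ha_su, hb_pr, hab, d2]
  · intro l μ p q r
    simp only [map_add, ha_pr, ha_su, hb_su, hab, d3]
end

section
/- Let A be a complex vector space with ∂, two λ-products ≺_λ and ≻_λ, and two commuting ℂ-linear maps α, β : A → A commuting with ∂ that are multiplicative with respect to both ≺_λ and ≻_λ. Define p *_λ q = p ≺_λ q + p ≻_λ q. Then (A, ≺_λ, ≻_λ, α, β) is a BiHom-dendriform conformal algebra if and only if (A, *_λ, α, β) is a BiHom-associative conformal algebra and (A, α, β) is a conformal bimodule over (A, *_λ, α, β) with left action p ·_λ m = p ≻_λ m and right action m ·_λ p = m ≺_λ p. -/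
open scoped TensorProduct

/-- `(A, ≺, ≻, α, β)` is BiHom-dendriform conformal iff
`(A, * = ≺ + ≻, α, β)` is BiHom-associative conformal and `(A, α, β)` is a
conformal bimodule over it with left action `≻` and right action `≺`. -/
theorem dendriform_iff_assoc_and_bimodule (A : Type*) [AddCommGroup A] [Module ℂ A]
    (D α β : A →ₗ[ℂ] A) (pr su : ℂ → A → A → A)
    (hpr : ConfSesq D D D pr) (hsu : ConfSesq D D D su)
    (hab : ∀ p, α (β p) = β (α p))
    (haD : ∀ p, α (D p) = D (α p))
    (hbD : ∀ p, β (D p) = D (β p))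
    (ha_pr : ∀ (l : ℂ) p q, α (pr l p q) = pr l (α p) (α q))
    (ha_su : ∀ (l : ℂ) p q, α (su l p q) = su l (α p) (α q))
    (hb_pr : ∀ (l : ℂ) p q, β (pr l p q) = pr l (β p) (β q))
    (hb_su : ∀ (l : ℂ) p q, β (su l p q) = su l (β p) (β q)) :
    BiHomDendriformConformal A D α β pr su ↔
      (BiHomAssocConformal A D α β (fun l p q => pr l p q + su l p q) ∧
        ConformalBimodule A A D α β (fun l p q => pr l p q + su l p q) D α β
          (fun l p x => su l p x) (fun l x p => pr l x p)) := by
  constructor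
  · intro h
    refine ⟨⟨⟨?_, ?_, ?_, ?_, ?_, ?_⟩, hab, haD, hbD, ?_, ?_, ?_⟩,
      ⟨hsu, hpr, hab, ha_su, hb_su, ha_pr, hb_pr, ?_, ?_, ?_⟩⟩
    · intro l p p' q
      simp only [hpr.add_left, hsu.add_left]
      abel
    · intro l c p q
      simp only [hpr.smul_left, hsu.smul_left, smul_add]
    · intro l p q q'
      simp only [hpr.add_right, hsu.add_right]
      abel
    · intro l c p q
      simp only [hpr.smul_right, hsu.smul_right, smul_add]
    · intro l p q
      simp only [hpr.sesq_left, hsu.sesq_left, smul_add]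
    · intro l p q
      simp only [hpr.sesq_right, hsu.sesq_right, smul_add, map_add]
      abel
    · intro l p q
      simp only [map_add, ha_pr, ha_su]
    · intro l p q
      simp only [map_add, hb_pr, hb_su]
    · intro l μ p q r
      show pr l (α p) (pr μ q r + su μ q r) + su l (α p) (pr μ q r + su μ q r)
        = pr (l + μ) (pr l p q + su l p q) (β r) + su (l + μ) (pr l p q + su l p q) (β r)
      rw [← h.d1, ← h.d3, hsu.add_right, hpr.add_left, h.d2, h.d3]
      abel
    · intro l μ p q x
      exact (h.d3 l μ p q x).symm
    · intro l μ x p q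
      exact h.d1 l μ x p q
    · intro l μ p x q
      exact h.d2 l μ p x q
  · rintro ⟨_, hm⟩
    exact ⟨hpr, hsu, hab, haD, hbD, ha_pr, hb_pr, ha_su, hb_su,
      fun l μ p q r => hm.assoc_rr l μ p q r,
      fun l μ p q r => hm.assoc_lr l μ p q r,
      fun l μ p q r => (hm.assoc_ll l μ p q r).symm⟩
end

section
/- Let (A, ≺_λ, ≻_λ, ·_λ, α, β) be a BiHom-tridendriform conformal algebra. Define new products by p ≻'_λ q = p ≻_λ q and p ≺'_λ q = p ≺_λ q + p ·_λ q. Then (A, ≺'_λ, ≻'_λ, α, β) is a BiHom-dendriform conformal algebra. -/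
open scoped TensorProduct

/-- a BiHom-tridendriform conformal algebra yields a BiHom-dendriform
conformal algebra via `p ≻' q = p ≻ q` and `p ≺' q = p ≺ q + p · q`. -/
theorem tridendriform_to_dendriform (A : Type*) [AddCommGroup A] [Module ℂ A]
    (D α β : A →ₗ[ℂ] A) (pr su dt : ℂ → A → A → A)
    (h : BiHomTridendriformConformal A D α β pr su dt) :
    BiHomDendriformConformal A D α β (fun l p q => pr l p q + dt l p q) su := by
  have P := h.sesq_pr
  have S := h.sesq_su
  have T := h.sesq_dt
  refine ⟨⟨?_, ?_, ?_, ?_, ?_, ?_⟩, S, h.comm_ab, h.comm_aD, h.comm_bD, ?_, ?_,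
    h.mult_a_su, h.mult_b_su, ?_, ?_, ?_⟩
  · intro l p p' q
    simp only [P.add_left, T.add_left]
    abel
  · intro l c p q
    simp only [P.smul_left, T.smul_left, smul_add]
  · intro l p q q'
    simp only [P.add_right, T.add_right]
    abel
  · intro l c p q
    simp only [P.smul_right, T.smul_right, smul_add]
  · intro l p q
    simp only [P.sesq_left, T.sesq_left, smul_add]
  · intro l p q
    simp only [P.sesq_right, T.sesq_right, smul_add, map_add]
    abel
  · intro l p q
    simp only [map_add, h.mult_a_pr, h.mult_a_dt]
  · intro l p q
    simp only [map_add, h.mult_b_pr, h.mult_b_dt]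
  · intro l μ p q r
    simp only [P.add_left, T.add_left, h.t1, ← h.t4, ← h.t6, ← h.t7, P.add_right, T.add_right]
    abel
  · intro l μ p q r
    simp only [S.add_right, h.t2, h.t5]
  · intro l μ p q r
    simp only [h.t3, S.add_left]
    abel
end

section
/- Let (A, ≺_λ, ≻_λ, ·_λ, α, β) be a BiHom-tridendriform conformal algebra. Define p *_λ q = p ≺_λ q + p ≻_λ q + p ·_λ q. Then (A, *_λ, α, β) is a BiHom-associative conformal algebra. -/
open scoped TensorProduct

/-- a BiHom-tridendriform conformal algebra yields a BiHom-associative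
conformal algebra via `p * q = p ≺ q + p ≻ q + p · q`. -/
theorem tridendriform_to_assoc (A : Type*) [AddCommGroup A] [Module ℂ A]
    (D α β : A →ₗ[ℂ] A) (pr su dt : ℂ → A → A → A)
    (h : BiHomTridendriformConformal A D α β pr su dt) :
    BiHomAssocConformal A D α β (fun l p q => pr l p q + su l p q + dt l p q) := by
  constructor
  · constructor
    · intro l p p' q
      simp only [h.sesq_pr.add_left, h.sesq_su.add_left, h.sesq_dt.add_left]
      abel
    · intro l c p q
      simp only [h.sesq_pr.smul_left, h.sesq_su.smul_left, h.sesq_dt.smul_left, smul_add]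
    · intro l p q q'
      simp only [h.sesq_pr.add_right, h.sesq_su.add_right, h.sesq_dt.add_right]
      abel
    · intro l c p q
      simp only [h.sesq_pr.smul_right, h.sesq_su.smul_right, h.sesq_dt.smul_right, smul_add]
    · intro l p q
      simp only [h.sesq_pr.sesq_left, h.sesq_su.sesq_left, h.sesq_dt.sesq_left, smul_add]
    · intro l p q
      simp only [h.sesq_pr.sesq_right, h.sesq_su.sesq_right, h.sesq_dt.sesq_right, smul_add,
        map_add]
      abel
  · exact h.comm_ab
  · exact h.comm_aD
  · exact h.comm_bD
  · intro l p q
    simp only [map_add, h.mult_a_pr, h.mult_a_su, h.mult_a_dt]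
  · intro l p q
    simp only [map_add, h.mult_b_pr, h.mult_b_su, h.mult_b_dt]
  · intro l μ p q r
    change pr l (α p) (pr μ q r + su μ q r + dt μ q r)
        + su l (α p) (pr μ q r + su μ q r + dt μ q r)
        + dt l (α p) (pr μ q r + su μ q r + dt μ q r)
      = pr (l + μ) (pr l p q + su l p q + dt l p q) (β r)
        + su (l + μ) (pr l p q + su l p q + dt l p q) (β r)
        + dt (l + μ) (pr l p q + su l p q + dt l p q) (β r)
    rw [← h.t1, ← h.t3]
    simp only [h.sesq_pr.add_left, h.sesq_dt.add_left, h.sesq_su.add_right,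
      h.sesq_dt.add_right]
    rw [h.t2, h.t4, h.t5, h.t6, h.t7]
    abel
end

section
/- Let (A, ≺_λ, ≻_λ, α, β) be a BiHom-dendriform conformal algebra. Define p *_λ q = p ≺_λ q + p ≻_λ q. Then (A, *_λ, α, β) is a BiHom-associative conformal algebra. -/
open scoped TensorProduct

/-- a BiHom-dendriform conformal algebra yields a BiHom-associative
conformal algebra via `p * q = p ≺ q + p ≻ q`. -/
theorem dendriform_to_assoc (A : Type*) [AddCommGroup A] [Module ℂ A]
    (D α β : A →ₗ[ℂ] A) (pr su : ℂ → A → A → A)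
    (h : BiHomDendriformConformal A D α β pr su) :
    BiHomAssocConformal A D α β (fun l p q => pr l p q + su l p q) := by
  refine ⟨⟨?_, ?_, ?_, ?_, ?_, ?_⟩, h.comm_ab, h.comm_aD, h.comm_bD, ?_, ?_, ?_⟩
  · intro l p p' q
    simp only [h.sesq_pr.add_left, h.sesq_su.add_left]
    abel
  · intro l c p q
    simp only [h.sesq_pr.smul_left, h.sesq_su.smul_left, smul_add]
  · intro l p q q'
    simp only [h.sesq_pr.add_right, h.sesq_su.add_right]
    abel
  · intro l c p q
    simp only [h.sesq_pr.smul_right, h.sesq_su.smul_right, smul_add]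
  · intro l p q
    simp only [h.sesq_pr.sesq_left, h.sesq_su.sesq_left, smul_add]
  · intro l p q
    simp only [h.sesq_pr.sesq_right, h.sesq_su.sesq_right, smul_add, map_add]
    abel
  · intro l p q
    simp only [map_add, h.mult_a_pr, h.mult_a_su]
  · intro l p q
    simp only [map_add, h.mult_b_pr, h.mult_b_su]
  · intro l μ p q r
    change pr l (α p) (pr μ q r + su μ q r) + su l (α p) (pr μ q r + su μ q r)
      = pr (l + μ) (pr l p q + su l p q) (β r) + su (l + μ) (pr l p q + su l p q) (β r)
    rw [← h.d1, ← h.d3, h.sesq_su.add_right, ← h.d2, h.sesq_pr.add_left]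
    abel
end

section
/- Let A be a complex vector space with ∂, three λ-products ≺_λ, ≻_λ, ∨_λ, and two commuting ℂ-linear maps α, β : A → A commuting with ∂ that are multiplicative with respect to ≺_λ, ≻_λ and ∨_λ. Define p *_λ q = p ≺_λ q + p ≻_λ q + p ∨_λ q. Then (A, ≺_λ, ≻_λ, ∨_λ, α, β) is a BiHom-NS-conformal algebra if and only if (A, *_λ, α, β) is a BiHom-associative conformal algebra and (A, α, β) is a conformal bimodule over (A, *_λ, α, β) with left action p ·_λ m = p ≻_λ m and right action m ·_λ p = m ≺_λ p. -/
open scoped TensorProduct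

/-- `(A, ≺, ≻, ∨, α, β)` is BiHom-NS-conformal iff
`(A, * = ≺ + ≻ + ∨, α, β)` is BiHom-associative conformal and `(A, α, β)` is a
conformal bimodule over it with left action `≻` and right action `≺`. -/
theorem ns_iff_assoc_and_bimodule (A : Type*) [AddCommGroup A] [Module ℂ A]
    (D α β : A →ₗ[ℂ] A) (pr su ve : ℂ → A → A → A)
    (hpr : ConfSesq D D D pr) (hsu : ConfSesq D D D su) (hve : ConfSesq D D D ve)
    (hab : ∀ p, α (β p) = β (α p))
    (haD : ∀ p, α (D p) = D (α p))
    (hbD : ∀ p, β (D p) = D (β p))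
    (ha_pr : ∀ (l : ℂ) p q, α (pr l p q) = pr l (α p) (α q))
    (ha_su : ∀ (l : ℂ) p q, α (su l p q) = su l (α p) (α q))
    (ha_ve : ∀ (l : ℂ) p q, α (ve l p q) = ve l (α p) (α q))
    (hb_pr : ∀ (l : ℂ) p q, β (pr l p q) = pr l (β p) (β q))
    (hb_su : ∀ (l : ℂ) p q, β (su l p q) = su l (β p) (β q))
    (hb_ve : ∀ (l : ℂ) p q, β (ve l p q) = ve l (β p) (β q)) :
    BiHomNSConformal A D α β pr su ve ↔
      (BiHomAssocConformal A D α β (fun l p q => pr l p q + su l p q + ve l p q) ∧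
        ConformalBimodule A A D α β (fun l p q => pr l p q + su l p q + ve l p q) D α β
          (fun l p x => su l p x) (fun l x p => pr l x p)) := by
  constructor
  · intro h
    refine ⟨⟨⟨?_, ?_, ?_, ?_, ?_, ?_⟩, hab, haD, hbD, ?_, ?_, ?_⟩,
      ⟨hsu, hpr, hab, ha_su, hb_su, ha_pr, hb_pr, h.ns3, h.ns1, h.ns2⟩⟩
    · intro l p p' q
      simp only [hpr.add_left, hsu.add_left, hve.add_left]
      abel
    · intro l c p q
      simp only [hpr.smul_left, hsu.smul_left, hve.smul_left, smul_add]
    · intro l p q q'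
      simp only [hpr.add_right, hsu.add_right, hve.add_right]
      abel
    · intro l c p q
      simp only [hpr.smul_right, hsu.smul_right, hve.smul_right, smul_add]
    · intro l p q
      simp only [hpr.sesq_left, hsu.sesq_left, hve.sesq_left, smul_add]
    · intro l p q
      simp only [hpr.sesq_right, hsu.sesq_right, hve.sesq_right, smul_add, map_add]
      abel
    · intro l p q
      simp only [map_add, ha_pr, ha_su, ha_ve]
    · intro l p q
      simp only [map_add, hb_pr, hb_su, hb_ve]
    · intro l μ p q r
      have h4 := h.ns4 l μ p q r
      beta_reduce
      rw [← h.ns1 l μ p q r, h.ns3 l μ p q r, hsu.add_right, hsu.add_right,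
        hpr.add_left, hpr.add_left, ← h.ns2 l μ p q r]
      linear_combination (norm := abel) -h4
  · rintro ⟨h, b⟩
    have n1 := b.assoc_rr
    have n2 := b.assoc_lr
    have n3 := b.assoc_ll
    refine ⟨hpr, hsu, hve, hab, haD, hbD, ha_pr, hb_pr, ha_su, hb_su, ha_ve, hb_ve,
      n1, n2, n3, ?_⟩
    intro l μ p q r
    have h4 := h.assoc l μ p q r
    have h1 := n1 l μ p q r
    have h2 := n2 l μ p q r
    have h3 := n3 l μ p q r
    beta_reduce at h1 h2 h3 h4
    rw [← h1, h3, hsu.add_right, hsu.add_right,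
      hpr.add_left, hpr.add_left, ← h2] at h4
    linear_combination (norm := abel) -h4
end

section
/- Let (A, ·_λ, α_A, β_A) be a BiHom-associative conformal algebra, M a complex vector space with ∂_M and commuting ℂ-linear maps α_M, β_M, l_λ : (p,m) ↦ p ·_λ m and r_λ : (m,p) ↦ m ·_λ p conformally sesquilinear actions, and ⊙_λ a λ-product on M. Then (M, ⊙_λ, l_λ, r_λ, α_M, β_M) is a conformal A-bimodule algebra (i.e. A ⊕ M with product (p,m) *_λ (p',m') = (p ·_λ p', p ·_λ m' + m ·_λ p' + m ⊙_λ m') and structure maps (p,m) ↦ (α_A(p), α_M(m)), (p,m) ↦ (β_A(p), β_M(m)) is a BiHom-associative conformal algebra) if and only if (M, l_λ, r_λ, α_M, β_M) is a conformal A-bimodule, (M, ⊙_λ, α_M, β_M) is a BiHom-associative conformal algebra, and for all p ∈ A, m, m' ∈ M, λ, μ ∈ ℂ: α_A(p) ·_λ (m ⊙_μ m') = (p ·_λ m) ⊙_{λ+μ} β_M(m'); α_M(m) ⊙_λ (m' ·_μ p) = (m ⊙_λ m') ·_{λ+μ} β_A(p); α_M(m) ⊙_λ (p ·_μ m') = (m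 ·_λ p) ⊙_{λ+μ} β_M(m'). -/
open scoped TensorProduct

theorem ConfSesq.zero_left' {M N P : Type*} [AddCommGroup M] [Module ℂ M]
    [AddCommGroup N] [Module ℂ N] [AddCommGroup P] [Module ℂ P]
    {DM : M →ₗ[ℂ] M} {DN : N →ₗ[ℂ] N} {DP : P →ₗ[ℂ] P}
    {f : ℂ → M → N → P} (h : ConfSesq DM DN DP f) (l : ℂ) (q : N) : f l 0 q = 0 := by
  simpa using h.smul_left l 0 0 q

theorem ConfSesq.zero_right' {M N P : Type*} [AddCommGroup M] [Module ℂ M]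
    [AddCommGroup N] [Module ℂ N] [AddCommGroup P] [Module ℂ P]
    {DM : M →ₗ[ℂ] M} {DN : N →ₗ[ℂ] N} {DP : P →ₗ[ℂ] P}
    {f : ℂ → M → N → P} (h : ConfSesq DM DN DP f) (l : ℂ) (p : M) : f l p 0 = 0 := by
  simpa using h.smul_right l 0 p 0

/-- `(M, ⊙, l, r, α_M, β_M)` is a conformal `A`-bimodule algebra
(i.e. `A ⊕ M` with the indicated product is BiHom-associative conformal) iff
`M` is a conformal `A`-bimodule, `(M, ⊙, α_M, β_M)` is BiHom-associative conformal,
and the three compatibility identities hold. -/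
theorem bimodule_algebra_iff (A M : Type*) [AddCommGroup A] [Module ℂ A]
    [AddCommGroup M] [Module ℂ M]
    (DA αA βA : A →ₗ[ℂ] A) (mA : ℂ → A → A → A)
    (DM αM βM : M →ₗ[ℂ] M)
    (lact : ℂ → A → M → M) (ract : ℂ → M → A → M) (odot : ℂ → M → M → M)
    (hA : BiHomAssocConformal A DA αA βA mA)
    (hMab : ∀ x, αM (βM x) = βM (αM x))
    (hMaD : ∀ x, αM (DM x) = DM (αM x))
    (hMbD : ∀ x, βM (DM x) = DM (βM x))
    (hl : ConfSesq DA DM DM lact) (hr : ConfSesq DM DA DM ract)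
    (ho : ConfSesq DM DM DM odot) :
    BiHomAssocConformal (A × M) (DA.prodMap DM) (αA.prodMap αM) (βA.prodMap βM)
      (fun l x y => (mA l x.1 y.1, lact l x.1 y.2 + ract l x.2 y.1 + odot l x.2 y.2)) ↔
      (ConformalBimodule A M DA αA βA mA DM αM βM lact ract ∧
        BiHomAssocConformal M DM αM βM odot ∧
        (∀ (l μ : ℂ) p x y, lact l (αA p) (odot μ x y) = odot (l + μ) (lact l p x) (βM y)) ∧
        (∀ (l μ : ℂ) x y p, odot l (αM x) (ract μ y p) = ract (l + μ) (odot l x y) (βA p)) ∧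
        (∀ (l μ : ℂ) x p y, odot l (αM x) (lact μ p y) = odot (l + μ) (ract l x p) (βM y))) := by
  constructor
  · intro h
    refine ⟨⟨hl, hr, hMab, fun l p x => ?_, fun l p x => ?_, fun l x p => ?_, fun l x p => ?_,
      fun l μ p q x => ?_, fun l μ x p q => ?_, fun l μ p x q => ?_⟩,
      ⟨ho, hMab, hMaD, hMbD, fun l x y => ?_, fun l x y => ?_, fun l μ x y z => ?_⟩,
      fun l μ p x y => ?_, fun l μ x y p => ?_, fun l μ x p y => ?_⟩
    · have e := congrArg Prod.snd (h.mult_a l (p, 0) (0, x))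
      simp only [LinearMap.prodMap_apply, map_zero, add_zero, zero_add, hA.sesq.zero_left',
        hA.sesq.zero_right', hl.zero_left', hl.zero_right', hr.zero_left', hr.zero_right',
        ho.zero_left', ho.zero_right'] at e
      exact e
    · have e := congrArg Prod.snd (h.mult_b l (p, 0) (0, x))
      simp only [LinearMap.prodMap_apply, map_zero, add_zero, zero_add, hA.sesq.zero_left',
        hA.sesq.zero_right', hl.zero_left', hl.zero_right', hr.zero_left', hr.zero_right',
        ho.zero_left', ho.zero_right'] at e
      exact e
    · have e := congrArg Prod.snd (h.mult_a l (0, x) (p, 0))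
      simp only [LinearMap.prodMap_apply, map_zero, add_zero, zero_add, hA.sesq.zero_left',
        hA.sesq.zero_right', hl.zero_left', hl.zero_right', hr.zero_left', hr.zero_right',
        ho.zero_left', ho.zero_right'] at e
      exact e
    · have e := congrArg Prod.snd (h.mult_b l (0, x) (p, 0))
      simp only [LinearMap.prodMap_apply, map_zero, add_zero, zero_add, hA.sesq.zero_left',
        hA.sesq.zero_right', hl.zero_left', hl.zero_right', hr.zero_left', hr.zero_right',
        ho.zero_left', ho.zero_right'] at e
      exact e
    · have e := congrArg Prod.snd (h.assoc l μ (p, 0) (q, 0) (0, x))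
      simp only [LinearMap.prodMap_apply, map_zero, add_zero, zero_add, hA.sesq.zero_left',
        hA.sesq.zero_right', hl.zero_left', hl.zero_right', hr.zero_left', hr.zero_right',
        ho.zero_left', ho.zero_right'] at e
      exact e.symm
    · have e := congrArg Prod.snd (h.assoc l μ (0, x) (p, 0) (q, 0))
      simp only [LinearMap.prodMap_apply, map_zero, add_zero, zero_add, hA.sesq.zero_left',
        hA.sesq.zero_right', hl.zero_left', hl.zero_right', hr.zero_left', hr.zero_right',
        ho.zero_left', ho.zero_right'] at e
      exact e.symm
    · have e := congrArg Prod.snd (h.assoc l μ (p, 0) (0, x) (q, 0))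
      simp only [LinearMap.prodMap_apply, map_zero, add_zero, zero_add, hA.sesq.zero_left',
        hA.sesq.zero_right', hl.zero_left', hl.zero_right', hr.zero_left', hr.zero_right',
        ho.zero_left', ho.zero_right'] at e
      exact e.symm
    · have e := congrArg Prod.snd (h.mult_a l (0, x) (0, y))
      simp only [LinearMap.prodMap_apply, map_zero, add_zero, zero_add, hA.sesq.zero_left',
        hA.sesq.zero_right', hl.zero_left', hl.zero_right', hr.zero_left', hr.zero_right',
        ho.zero_left', ho.zero_right'] at e
      exact e
    · have e := congrArg Prod.snd (h.mult_b l (0, x) (0, y))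
      simp only [LinearMap.prodMap_apply, map_zero, add_zero, zero_add, hA.sesq.zero_left',
        hA.sesq.zero_right', hl.zero_left', hl.zero_right', hr.zero_left', hr.zero_right',
        ho.zero_left', ho.zero_right'] at e
      exact e
    · have e := congrArg Prod.snd (h.assoc l μ (0, x) (0, y) (0, z))
      simp only [LinearMap.prodMap_apply, map_zero, add_zero, zero_add, hA.sesq.zero_left',
        hA.sesq.zero_right', hl.zero_left', hl.zero_right', hr.zero_left', hr.zero_right',
        ho.zero_left', ho.zero_right'] at e
      exact e
    · have e := congrArg Prod.snd (h.assoc l μ (p, 0) (0, x) (0, y))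
      simp only [LinearMap.prodMap_apply, map_zero, add_zero, zero_add, hA.sesq.zero_left',
        hA.sesq.zero_right', hl.zero_left', hl.zero_right', hr.zero_left', hr.zero_right',
        ho.zero_left', ho.zero_right'] at e
      exact e
    · have e := congrArg Prod.snd (h.assoc l μ (0, x) (0, y) (p, 0))
      simp only [LinearMap.prodMap_apply, map_zero, add_zero, zero_add, hA.sesq.zero_left',
        hA.sesq.zero_right', hl.zero_left', hl.zero_right', hr.zero_left', hr.zero_right',
        ho.zero_left', ho.zero_right'] at e
      exact e
    · have e := congrArg Prod.snd (h.assoc l μ (0, x) (p, 0) (0, y))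
      simp only [LinearMap.prodMap_apply, map_zero, add_zero, zero_add, hA.sesq.zero_left',
        hA.sesq.zero_right', hl.zero_left', hl.zero_right', hr.zero_left', hr.zero_right',
        ho.zero_left', ho.zero_right'] at e
      exact e
  · rintro ⟨hB, hO, h1, h2, h3⟩
    have hs := hA.sesq
    refine ⟨⟨?_, ?_, ?_, ?_, ?_, ?_⟩, ?_, ?_, ?_, ?_, ?_, ?_⟩
    · intro l p p' q
      ext
      · simp [hs.add_left]
      · simp only [Prod.fst_add, Prod.snd_add, hl.add_left, hr.add_left, ho.add_left]; abel
    · intro l c p q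
      ext
      · simp [hs.smul_left]
      · simp [hl.smul_left, hr.smul_left, ho.smul_left]
    · intro l p q q'
      ext
      · simp [hs.add_right]
      · simp only [Prod.fst_add, Prod.snd_add, hl.add_right, hr.add_right, ho.add_right]; abel
    · intro l c p q
      ext
      · simp [hs.smul_right]
      · simp [hl.smul_right, hr.smul_right, ho.smul_right]
    · intro l p q
      ext
      · simp [hs.sesq_left]
      · simp only [LinearMap.prodMap_apply, Prod.smul_snd, hl.sesq_left, hr.sesq_left,
          ho.sesq_left, smul_add]
    · intro l p q
      ext
      · simp [hs.sesq_right]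
      · simp only [LinearMap.prodMap_apply, Prod.smul_snd, Prod.snd_add, hl.sesq_right,
          hr.sesq_right, ho.sesq_right, smul_add, map_add]; abel
    · intro p; ext <;> simp [hA.comm_ab, hMab]
    · intro p; ext <;> simp [hA.comm_aD, hMaD]
    · intro p; ext <;> simp [hA.comm_bD, hMbD]
    · intro l p q; ext <;> simp [hA.mult_a, hB.l_a, hB.r_a, hO.mult_a]
    · intro l p q; ext <;> simp [hA.mult_b, hB.l_b, hB.r_b, hO.mult_b]
    · intro l μ p q r
      ext
      · simp [hA.assoc]
      · simp only [LinearMap.prodMap_apply, hl.add_right, hr.add_left, ho.add_left, ho.add_right,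
          hB.assoc_ll, hB.assoc_rr, hB.assoc_lr, hO.assoc, h1, h2, h3]; abel
end

section
/- Let A be a complex vector space with ∂, three λ-products ≺_λ, ≻_λ, ·_λ, and two commuting ℂ-linear maps α, β : A → A commuting with ∂ that are multiplicative with respect to ≺_λ, ≻_λ and ·_λ. Define p *_λ q = p ≺_λ q + p ≻_λ q + p ·_λ q. Then (A, ≺_λ, ≻_λ, ·_λ, α, β) is a BiHom-tridendriform conformal algebra if and only if (A, *_λ, α, β) is a BiHom-associative conformal algebra and (A, ·_λ, ≻_λ, ≺_λ, α, β) is a conformal (A, *_λ, α, β)-bimodule algebra, where the left action is p ·_λ m = p ≻_λ m, the right action is m ·_λ p = m ≺_λ p, and the internal product is ⊙_λ = ·_λ. -/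
open scoped TensorProduct

/-- `(A, ≺, ≻, ·, α, β)` is BiHom-tridendriform conformal iff
`(A, * = ≺ + ≻ + ·, α, β)` is BiHom-associative conformal and
`(A, ·, ≻, ≺, α, β)` is a conformal `(A, *, α, β)`-bimodule algebra (i.e. it is a
conformal bimodule with left action `≻`, right action `≺`, and the direct sum
`A ⊕ A` with internal product `⊙ = ·` is BiHom-associative conformal). -/
theorem tridendriform_iff_bimodule_algebra (A : Type*) [AddCommGroup A] [Module ℂ A]
    (D α β : A →ₗ[ℂ] A) (pr su dt : ℂ → A → A → A)
    (hpr : ConfSesq D D D pr) (hsu : ConfSesq D D D su) (hdt : ConfSesq D D D dt)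
    (hab : ∀ p, α (β p) = β (α p))
    (haD : ∀ p, α (D p) = D (α p))
    (hbD : ∀ p, β (D p) = D (β p))
    (ha_pr : ∀ (l : ℂ) p q, α (pr l p q) = pr l (α p) (α q))
    (ha_su : ∀ (l : ℂ) p q, α (su l p q) = su l (α p) (α q))
    (ha_dt : ∀ (l : ℂ) p q, α (dt l p q) = dt l (α p) (α q))
    (hb_pr : ∀ (l : ℂ) p q, β (pr l p q) = pr l (β p) (β q))
    (hb_su : ∀ (l : ℂ) p q, β (su l p q) = su l (β p) (β q))
    (hb_dt : ∀ (l : ℂ) p q, β (dt l p q) = dt l (β p) (β q)) :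
    BiHomTridendriformConformal A D α β pr su dt ↔
      (BiHomAssocConformal A D α β (fun l p q => pr l p q + su l p q + dt l p q) ∧
        ConformalBimodule A A D α β (fun l p q => pr l p q + su l p q + dt l p q) D α β
          (fun l p x => su l p x) (fun l x p => pr l x p) ∧
        BiHomAssocConformal (A × A) (D.prodMap D) (α.prodMap α) (β.prodMap β)
          (fun l x y => (pr l x.1 y.1 + su l x.1 y.1 + dt l x.1 y.1,
            su l x.1 y.2 + pr l x.2 y.1 + dt l x.2 y.2))) := by
  have z1 : ∀ l q, pr l 0 q = 0 := fun l q => by simpa using hpr.smul_left l 0 0 q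
  have z2 : ∀ l q, pr l q 0 = 0 := fun l q => by simpa using hpr.smul_right l 0 q 0
  have z3 : ∀ l q, su l 0 q = 0 := fun l q => by simpa using hsu.smul_left l 0 0 q
  have z4 : ∀ l q, su l q 0 = 0 := fun l q => by simpa using hsu.smul_right l 0 q 0
  have z5 : ∀ l q, dt l 0 q = 0 := fun l q => by simpa using hdt.smul_left l 0 0 q
  have z6 : ∀ l q, dt l q 0 = 0 := fun l q => by simpa using hdt.smul_right l 0 q 0
  have hst : ConfSesq D D D (fun l p q => pr l p q + su l p q + dt l p q) := by
    constructor <;> intros <;>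
      simp only [hpr.add_left, hsu.add_left, hdt.add_left, hpr.smul_left, hsu.smul_left,
        hdt.smul_left, hpr.add_right, hsu.add_right, hdt.add_right, hpr.smul_right,
        hsu.smul_right, hdt.smul_right, hpr.sesq_left, hsu.sesq_left, hdt.sesq_left,
        hpr.sesq_right, hsu.sesq_right, hdt.sesq_right, map_add] <;> module
  constructor
  · intro h
    have e1 := h.t1
    have e3 := h.t3
    simp only [hpr.add_right] at e1
    simp only [hsu.add_left] at e3
    have hassoc : ∀ (l μ : ℂ) p q r,
        pr l (α p) (pr μ q r + su μ q r + dt μ q r) + su l (α p) (pr μ q r + su μ q r + dt μ q r)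
          + dt l (α p) (pr μ q r + su μ q r + dt μ q r)
        = pr (l + μ) (pr l p q + su l p q + dt l p q) (β r)
          + su (l + μ) (pr l p q + su l p q + dt l p q) (β r)
          + dt (l + μ) (pr l p q + su l p q + dt l p q) (β r) := by
      intro l μ p q r
      simp only [hpr.add_left, hsu.add_left, hdt.add_left, hpr.add_right, hsu.add_right,
        hdt.add_right, e1, e3, h.t2, h.t4, h.t5, h.t6, h.t7]
      abel
    refine ⟨⟨hst, hab, haD, hbD, ?_, ?_, hassoc⟩,
      ⟨hsu, hpr, hab, ha_su, hb_su, ha_pr, hb_pr, ?_, ?_, ?_⟩,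
      ⟨?_, ?_, ?_, ?_, ?_, ?_, ?_⟩⟩
    · intros; simp only [map_add, ha_pr, ha_su, ha_dt]
    · intros; simp only [map_add, hb_pr, hb_su, hb_dt]
    · intros; exact (h.t3 _ _ _ _ _).symm
    · intros; exact h.t1 _ _ _ _ _
    · intros; exact h.t2 _ _ _ _ _
    · constructor <;> intros <;> refine Prod.ext ?_ ?_ <;>
      simp only [hpr.add_left, hsu.add_left, hdt.add_left, hpr.smul_left, hsu.smul_left,
        hdt.smul_left, hpr.add_right, hsu.add_right, hdt.add_right, hpr.smul_right,
        hsu.smul_right, hdt.smul_right, hpr.sesq_left, hsu.sesq_left, hdt.sesq_left,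
        hpr.sesq_right, hsu.sesq_right, hdt.sesq_right, map_add, Prod.fst_add, Prod.snd_add,
        Prod.smul_fst, Prod.smul_snd, LinearMap.prodMap_apply] <;> module
    · intro p; exact Prod.ext (hab _) (hab _)
    · intro p; exact Prod.ext (haD _) (haD _)
    · intro p; exact Prod.ext (hbD _) (hbD _)
    · intros; refine Prod.ext ?_ ?_ <;>
        simp only [map_add, ha_pr, ha_su, ha_dt, LinearMap.prodMap_apply]
    · intros; refine Prod.ext ?_ ?_ <;>
        simp only [map_add, hb_pr, hb_su, hb_dt, LinearMap.prodMap_apply]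
    · intro l μ p q r
      refine Prod.ext (hassoc l μ p.1 q.1 r.1) ?_
      simp only [LinearMap.prodMap_apply]
      simp only [hpr.add_left, hsu.add_left, hdt.add_left, hpr.add_right, hsu.add_right,
        hdt.add_right, e1, e3, h.t2, h.t4, h.t5, h.t6, h.t7]
      abel
  · rintro ⟨-, hb, hs⟩
    have key := fun l μ p q r => congrArg Prod.snd (hs.assoc l μ p q r)
    simp only [LinearMap.prodMap_apply] at key
    refine ⟨hpr, hsu, hdt, hab, haD, hbD, ha_pr, hb_pr, ha_su, hb_su, ha_dt, hb_dt,
      hb.assoc_rr, hb.assoc_lr, fun l μ p q r => (hb.assoc_ll l μ p q r).symm, ?_, ?_, ?_, ?_⟩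
    · intro l μ p q r
      simpa [z1, z2, z3, z4, z5, z6] using key l μ (0, p) (q, 0) (0, r)
    · intro l μ p q r
      simpa [z1, z2, z3, z4, z5, z6] using key l μ (p, 0) (0, q) (0, r)
    · intro l μ p q r
      simpa [z1, z2, z3, z4, z5, z6] using key l μ (0, p) (0, q) (r, 0)
    · intro l μ p q r
      simpa [z1, z2, z3, z4, z5, z6] using key l μ (0, p) (0, q) (0, r)
end

section
/- Let (A, ·_λ) be an associative conformal algebra (a BiHom-associative conformal algebra with α = β = id), let R : A → A be a Rota-Baxter operator of weight θ for (A, ·_λ), and let α, β : A → A be two commuting endomorphisms of (A, ·_λ) (commuting with ∂) such that α ∘ R = R ∘ α and β ∘ R = R ∘ β. Define a new product p *_λ q = α(p) ·_λ β(q). Then (A, *_λ, α, β) is a BiHom-associative conformal algebra and R is a Rota-Baxter operator of weight θ on it, i.e. R(p) *_λ R(q) = R(R(p) *_λ q + p *_λ R(q) + θ(p *_λ q)) for all p, q ∈ A and λ ∈ ℂ. -/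
open scoped TensorProduct

/-- if `R` is a Rota-Baxter operator of weight `θ` on an associative
conformal algebra `(A, ·)` and `α, β` are commuting endomorphisms commuting with `R`,
then the Yau twist `p * q = α(p) · β(q)` is a BiHom-associative conformal algebra
and `R` is a Rota-Baxter operator of weight `θ` on it. -/
theorem rota_baxter_yau_twist (A : Type*) [AddCommGroup A] [Module ℂ A]
    (D α β Rop : A →ₗ[ℂ] A) (m : ℂ → A → A → A) (θ : ℂ)
    (hA : BiHomAssocConformal A D LinearMap.id LinearMap.id m)
    (hR : RotaBaxterWeight A D m θ Rop)
    (hab : ∀ p, α (β p) = β (α p))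
    (haD : ∀ p, α (D p) = D (α p))
    (hbD : ∀ p, β (D p) = D (β p))
    (ha_m : ∀ (l : ℂ) p q, α (m l p q) = m l (α p) (α q))
    (hb_m : ∀ (l : ℂ) p q, β (m l p q) = m l (β p) (β q))
    (hRa : ∀ p, Rop (α p) = α (Rop p))
    (hRb : ∀ p, Rop (β p) = β (Rop p)) :
    BiHomAssocConformal A D α β (fun l p q => m l (α p) (β q)) ∧
      RotaBaxterWeight A D (fun l p q => m l (α p) (β q)) θ Rop := by
  have hs := hA.sesq
  have has : ∀ (l μ : ℂ) p q r, m l p (m μ q r) = m (l + μ) (m l p q) r := hA.assoc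
  refine ⟨⟨⟨?_, ?_, ?_, ?_, ?_, ?_⟩, hab, haD, hbD, ?_, ?_, ?_⟩, ⟨hR.comm_D, ?_⟩⟩
  · intro l p p' q
    simp only [map_add, hs.add_left]
  · intro l c p q
    simp only [map_smul, hs.smul_left]
  · intro l p q q'
    simp only [map_add, hs.add_right]
  · intro l c p q
    simp only [map_smul, hs.smul_right]
  · intro l p q
    simp only [haD, hs.sesq_left]
  · intro l p q
    simp only [hbD, hs.sesq_right]
  · intro l p q
    simp only [ha_m, hab]
  · intro l p q
    simp only [hb_m, hab]
  · intro l μ p q r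
    simp only [ha_m, hb_m, hab, has]
  · intro l p q
    simp only [← hRa, ← hRb]
    exact hR.rb l (α p) (β q)
end

section
/- Let R : A → A be a Rota-Baxter operator of weight θ on a BiHom-associative conformal algebra (A, ·_λ, α, β) such that R commutes with α and β. Define p ≺_λ q = p ·_λ R(q), p ≻_λ q = R(p) ·_λ q, and p ∗·_λ q = θ(p ·_λ q). Then (A, ≺_λ, ≻_λ, ∗·_λ, α, β) is a BiHom-tridendriform conformal algebra. -/
open scoped TensorProduct

/-- a Rota-Baxter operator of weight `θ` on a BiHom-associative
conformal algebra, commuting with `α` and `β`, yields a BiHom-tridendriform conformal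
algebra via `p ≺ q = p · R(q)`, `p ≻ q = R(p) · q`, `p ∗· q = θ (p · q)`. -/
theorem rota_baxter_to_tridendriform (A : Type*) [AddCommGroup A] [Module ℂ A]
    (D α β Rop : A →ₗ[ℂ] A) (m : ℂ → A → A → A) (θ : ℂ)
    (hA : BiHomAssocConformal A D α β m)
    (hR : RotaBaxterWeight A D m θ Rop)
    (hRa : ∀ p, Rop (α p) = α (Rop p))
    (hRb : ∀ p, Rop (β p) = β (Rop p)) :
    BiHomTridendriformConformal A D α β
      (fun l p q => m l p (Rop q)) (fun l p q => m l (Rop p) q)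
      (fun l p q => θ • m l p q) := by
  have hs := hA.sesq
  have e1 : ∀ l p q, Rop (m l p (Rop q) + m l (Rop p) q + θ • m l p q)
      = m l (Rop p) (Rop q) := by
    intro l p q
    rw [hR.rb, add_comm (m l p (Rop q))]
  constructor
  case sesq_pr =>
    constructor <;> intros <;>
      simp only [map_add, map_smul, hs.add_left, hs.smul_left, hs.add_right, hs.smul_right,
        hs.sesq_left, hs.sesq_right, hR.comm_D]
  case sesq_su =>
    constructor <;> intros <;>
      simp only [map_add, map_smul, hs.add_left, hs.smul_left, hs.add_right, hs.smul_right,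
        hs.sesq_left, hs.sesq_right, hR.comm_D]
  case sesq_dt =>
    constructor <;> intros <;>
      simp only [map_add, map_smul, hs.add_left, hs.smul_left, hs.add_right, hs.smul_right,
        hs.sesq_left, hs.sesq_right, smul_add] <;>
      first | done | rw [smul_comm]
  case comm_ab => exact hA.comm_ab
  case comm_aD => exact hA.comm_aD
  case comm_bD => exact hA.comm_bD
  all_goals
    intros
    simp only [e1, hRa, hRb, map_smul, hA.mult_a, hA.mult_b, hs.smul_left, hs.smul_right,
      hA.assoc]
end
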